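/- (Three edges with uniformly nondegenerate directions in a tetrahedron with maximum angle condition) Let T be a tetrahedron all of whose face angles and dihedral angles are at most θ_M < π. Then T has three edges e₁, e₂, e₃ (not necessarily sharing a vertex) whose unit direction vectors t₁, t₂, t₃ satisfy |det[t₁,t₂,t₃]| = sin(θ₁) sin(θ₂) sin(θ₃) ≥ c_m, where θ₁ ∈ [π/3, θ_M] is the largest dihedral angle (associated with e₁), θ₂, θ₃ ∈ [(π−θ_M)/2, θ_M], and c_m = min{√3/2, sin θ_M} · min{cos(θ_M/2), sin θ_M}². Moreover (c_m/6)|e₁||e₂||e₃| ≤ |T| ≤ (1/6)|e₁||e₂||e₃|. -/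

import Mathlib

open EuclideanGeometry Real MeasureTheory
open scoped RealInnerProductSpace

/-- Component of `v` orthogonal to the direction `d`. -/
noncomputable def perpPart (d v : EuclideanSpace ℝ (Fin 3)) : EuclideanSpace ℝ (Fin 3) :=
  v - (⟪v, d⟫ / ⟪d, d⟫) • d

/-- Dihedral angle of a tetrahedron along the edge `PQ`, between the half-planes
towards `R` and `S`. -/
noncomputable def dihedralAngle (P Q R S : EuclideanSpace ℝ (Fin 3)) : ℝ :=
  InnerProductGeometry.angle (perpPart (Q - P) (R - P)) (perpPart (Q - P) (S - P))

/-- Unit direction vector of the segment from `P` to `Q`. -/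
noncomputable def unitDir (P Q : EuclideanSpace ℝ (Fin 3)) : EuclideanSpace ℝ (Fin 3) :=
  ‖Q - P‖⁻¹ • (Q - P)

/-- The solid simplex `{x | 0 ≤ x, ∑ xᵢ ≤ r}`. -/
def cornerSimplex (n : ℕ) (r : ℝ) : Set (Fin n → ℝ) := {x | (∀ i, 0 ≤ x i) ∧ ∑ i, x i ≤ r}

theorem isClosed_cornerSimplex (n : ℕ) (r : ℝ) : IsClosed (cornerSimplex n r) := by
  have h : cornerSimplex n r = (⋂ i, {x | 0 ≤ x i}) ∩ {x | ∑ i, x i ≤ r} := by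
    ext x; simp [cornerSimplex]
  rw [h]
  exact (isClosed_iInter fun i => isClosed_le continuous_const (continuous_apply i)).inter
    (isClosed_le (by fun_prop) continuous_const)

theorem cornerSimplex_eq_empty {n : ℕ} {r : ℝ} (hr : r < 0) : cornerSimplex n r = ∅ :=
  Set.eq_empty_of_forall_notMem fun _ hx =>
    absurd (Finset.sum_nonneg fun i _ => hx.1 i) (by linarith [hx.2])

theorem volume_cornerSimplex (n : ℕ) {r : ℝ} (hr : 0 ≤ r) :
    volume (cornerSimplex n r) = ENNReal.ofReal (r ^ n / n.factorial) := by
  induction n generalizing r with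
  | zero =>
    have : cornerSimplex 0 r = Set.univ := by
      ext x; simp [cornerSimplex, hr]
    simp [this, volume_pi]
  | succ n ih =>
    have hmp := (volume_preserving_piFinSuccAbove (fun _ : Fin (n + 1) => ℝ) 0).symm
    rw [← hmp.measure_preimage_equiv, Measure.volume_eq_prod, Measure.prod_apply
      ((isClosed_cornerSimplex _ _).measurableSet.preimage (MeasurableEquiv.measurable _))]
    have hslice : ∀ x : ℝ, volume (Prod.mk x ⁻¹'
        ((MeasurableEquiv.piFinSuccAbove (fun _ : Fin (n + 1) => ℝ) 0).symm ⁻¹'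
          cornerSimplex (n + 1) r)) =
        (Set.Icc 0 r).indicator (fun x => ENNReal.ofReal ((r - x) ^ n / n.factorial)) x := by
      intro x
      have hpre : (Prod.mk x ⁻¹'
        ((MeasurableEquiv.piFinSuccAbove (fun _ : Fin (n + 1) => ℝ) 0).symm ⁻¹'
          cornerSimplex (n + 1) r)) = {y | 0 ≤ x ∧ y ∈ cornerSimplex n (r - x)} := by
        ext y
        simp [cornerSimplex, MeasurableEquiv.piFinSuccAbove, Fin.forall_fin_succ, Fin.sum_univ_succ,
          le_sub_iff_add_le', and_assoc, Fin.insertNthEquiv]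
      rw [hpre]
      by_cases hx : x ∈ Set.Icc 0 r
      · rw [Set.indicator_of_mem hx, ← ih (sub_nonneg.2 hx.2)]
        simp [hx.1]
      · rw [Set.indicator_of_notMem hx]
        by_cases hx0 : 0 ≤ x
        · simp only [Set.mem_Icc, not_and, not_le] at hx
          simp [cornerSimplex_eq_empty (sub_neg.2 (hx hx0))]
        · simp [hx0]
    simp_rw [hslice]
    rw [lintegral_indicator measurableSet_Icc, ← ofReal_integral_eq_lintegral_ofReal]
    · rw [integral_Icc_eq_integral_Ioc, ← intervalIntegral.integral_of_le hr,
        intervalIntegral.integral_div, intervalIntegral.integral_comp_sub_left (fun x => x ^ n),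
        integral_pow]
      congr 1
      simp [Nat.factorial_succ]
      field_simp
    · exact (by fun_prop : Continuous fun x : ℝ => (r - x) ^ n / n.factorial).integrableOn_Icc
    · filter_upwards [ae_restrict_mem measurableSet_Icc] with x hx
      have := sub_nonneg.2 hx.2
      simp only [Pi.zero_apply]
      positivity


theorem convexHull_range_eq_image_stdSimplex {ι E : Type*} [Fintype ι] [AddCommGroup E]
    [Module ℝ E] (V : ι → E) :
    convexHull ℝ (Set.range V) = (fun w : ι → ℝ => ∑ i, w i • V i) '' stdSimplex ℝ ι := by
  classical
  rw [← convexHull_rangle_single_eq_stdSimplex]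
  change _ = Fintype.linearCombination ℝ V '' _
  rw [LinearMap.image_convexHull, ← Set.range_comp]
  simp [Function.comp_def]

/-- Determinant of three vectors of Euclidean space. -/
noncomputable def det₃ (u v w : EuclideanSpace ℝ (Fin 3)) : ℝ :=
  Matrix.det (Matrix.of ![u.ofLp, v.ofLp, w.ofLp])

theorem det₃_eq (u v w : EuclideanSpace ℝ (Fin 3)) :
    det₃ u v w = u 0 * v 1 * w 2 - u 0 * v 2 * w 1 - u 1 * v 0 * w 2 + u 1 * v 2 * w 0 +
      u 2 * v 0 * w 1 - u 2 * v 1 * w 0 := by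
  simp [det₃, Matrix.det_fin_three]

open scoped Pointwise in
theorem volume_convexHull_tetrahedron (P Q R S : EuclideanSpace ℝ (Fin 3)) :
    (volume (convexHull ℝ (Set.range ![P, Q, R, S]))).toReal =
      |det₃ (Q - P) (R - P) (S - P)| / 6 := by
  set M : Matrix (Fin 3) (Fin 3) ℝ :=
    (Matrix.of ![(Q - P).ofLp, (R - P).ofLp, (S - P).ofLp]).transpose
  have h : convexHull ℝ (Set.range ![P, Q, R, S]) =
      P +ᵥ (WithLp.ofLp ⁻¹' (Matrix.toLin' M '' cornerSimplex 3 1) :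
        Set (EuclideanSpace ℝ (Fin 3))) := by
    rw [convexHull_range_eq_image_stdSimplex]
    ext x
    simp only [Set.mem_image, Set.mem_vadd_set, Set.mem_preimage, vadd_eq_add]
    constructor
    · rintro ⟨w, ⟨hw, hw1⟩, rfl⟩
      refine ⟨∑ i, w i • ![P, Q, R, S] i - P, ⟨![w 1, w 2, w 3], ⟨?_, ?_⟩, ?_⟩, by abel⟩
      · intro i; fin_cases i <;> simp [hw]
      · simp [Fin.sum_univ_succ] at hw1 ⊢
        linarith [hw 0]
      · have h0 : w 0 = 1 - w 1 - w 2 - w 3 := by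
          simp [Fin.sum_univ_four] at hw1; linarith
        ext i
        fin_cases i <;>
          simp [M, Matrix.mulVec, dotProduct, Fin.sum_univ_three, Fin.sum_univ_four, h0] <;> ring
    · rintro ⟨y, ⟨w, ⟨hw, hw1⟩, hy⟩, rfl⟩
      refine ⟨![1 - w 0 - w 1 - w 2, w 0, w 1, w 2], ⟨?_, ?_⟩, ?_⟩
      · simp [Fin.sum_univ_three] at hw1
        intro i; fin_cases i <;> simp [hw]
        linarith
      · simp [Fin.sum_univ_four]
        ring
      · ext i
        have := congrFun hy i
        fin_cases i <;>
          simp [M, Matrix.mulVec, dotProduct, Fin.sum_univ_three, Fin.sum_univ_four] at this ⊢ <;>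
          linarith
  rw [h, measure_vadd, (PiLp.volume_preserving_ofLp (Fin 3)).measure_preimage_emb
    (MeasurableEquiv.toLp 2 (Fin 3 → ℝ)).symm.measurableEmbedding,
    Measure.addHaar_image_linearMap, volume_cornerSimplex 3 zero_le_one, LinearMap.det_toLin',
    Matrix.det_transpose, ← det₃, ENNReal.toReal_mul, ENNReal.toReal_ofReal (abs_nonneg _),
    ENNReal.toReal_ofReal (by positivity)]
  norm_num [Nat.factorial]
  ring

theorem inner_perpPart (d v w : EuclideanSpace ℝ (Fin 3)) :
    ⟪perpPart d v, perpPart d w⟫ = ⟪v, w⟫ - ⟪v, d⟫ * ⟪w, d⟫ / ⟪d, d⟫ := by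
  rcases eq_or_ne d 0 with rfl | hd
  · simp [perpPart]
  have : ⟪d, d⟫ ≠ 0 := inner_self_ne_zero.2 hd
  simp only [perpPart, inner_sub_left, inner_sub_right, real_inner_smul_left,
    real_inner_smul_right, real_inner_comm w d]
  field_simp
  ring

theorem perpPart_sub_self {d : EuclideanSpace ℝ (Fin 3)} (hd : d ≠ 0)
    (v : EuclideanSpace ℝ (Fin 3)) : perpPart d (v - d) = perpPart d v := by
  have : ⟪d, d⟫ ≠ 0 := inner_self_ne_zero.2 hd
  rw [perpPart, perpPart, inner_sub_left, sub_div, div_self this, sub_smul, one_smul]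
  abel

theorem perpPart_neg (d v : EuclideanSpace ℝ (Fin 3)) : perpPart (-d) v = perpPart d v := by
  simp [perpPart, neg_div]

theorem sin_angle_mul_norm_eq_norm_perpPart {d : EuclideanSpace ℝ (Fin 3)} (hd : d ≠ 0)
    (v : EuclideanSpace ℝ (Fin 3)) :
    sin (InnerProductGeometry.angle d v) * ‖v‖ = ‖perpPart d v‖ := by
  have hd' : 0 < ‖d‖ := norm_pos_iff.2 hd
  have h := InnerProductGeometry.sin_angle_mul_norm_mul_norm d v
  have h2 : ⟪d, d⟫ * ⟪v, v⟫ - ⟪d, v⟫ * ⟪d, v⟫ = (‖d‖ * ‖perpPart d v‖) ^ 2 := by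
    have : ⟪d, d⟫ ≠ 0 := inner_self_ne_zero.2 hd
    rw [mul_pow, ← real_inner_self_eq_norm_sq, ← real_inner_self_eq_norm_sq, inner_perpPart,
      real_inner_comm d v]
    field_simp
  rw [h2, sqrt_sq (by positivity)] at h
  exact mul_left_cancel₀ hd'.ne' (by linarith)

theorem abs_det₃_eq {u : EuclideanSpace ℝ (Fin 3)} (hu : u ≠ 0)
    (v w : EuclideanSpace ℝ (Fin 3)) :
    |det₃ u v w| = ‖u‖ * (sin (InnerProductGeometry.angle (perpPart u v) (perpPart u w)) *
      (‖perpPart u v‖ * ‖perpPart u w‖)) := by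
  rw [InnerProductGeometry.sin_angle_mul_norm_mul_norm, ← sqrt_sq (norm_nonneg u),
    ← sqrt_mul (sq_nonneg _), ← sqrt_sq_eq_abs, ← real_inner_self_eq_norm_sq]
  congr 1
  have : ⟪u, u⟫ ≠ 0 := inner_self_ne_zero.2 hu
  simp only [inner_perpPart]
  field_simp
  simp only [PiLp.inner_apply, Fin.sum_univ_three, det₃_eq, RCLike.inner_apply, conj_trivial]
  ring

/-- Cross product in Euclidean space. -/
noncomputable def cross₃ (u v : EuclideanSpace ℝ (Fin 3)) : EuclideanSpace ℝ (Fin 3) :=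
  !₂[u 1 * v 2 - u 2 * v 1, u 2 * v 0 - u 0 * v 2, u 0 * v 1 - u 1 * v 0]

theorem inner_perpPart_eq_inner_cross₃ {u : EuclideanSpace ℝ (Fin 3)} (hu : u ≠ 0)
    (v w : EuclideanSpace ℝ (Fin 3)) :
    ⟪perpPart u v, perpPart u w⟫ = ⟪cross₃ u v, cross₃ u w⟫ / ‖u‖ ^ 2 := by
  have : ⟪u, u⟫ ≠ 0 := inner_self_ne_zero.2 hu
  rw [inner_perpPart, ← real_inner_self_eq_norm_sq]
  field_simp
  simp only [PiLp.inner_apply, Fin.sum_univ_three, cross₃, RCLike.inner_apply, conj_trivial,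
    Matrix.cons_val]
  ring

theorem norm_perpPart_eq_norm_cross₃ {u : EuclideanSpace ℝ (Fin 3)} (hu : u ≠ 0)
    (v : EuclideanSpace ℝ (Fin 3)) : ‖perpPart u v‖ = ‖cross₃ u v‖ / ‖u‖ := by
  rw [← sq_eq_sq₀ (by positivity) (by positivity), div_pow, ← real_inner_self_eq_norm_sq,
    inner_perpPart_eq_inner_cross₃ hu, real_inner_self_eq_norm_sq]

theorem angle_perpPart_eq_angle_cross₃ {u : EuclideanSpace ℝ (Fin 3)} (hu : u ≠ 0)
    (v w : EuclideanSpace ℝ (Fin 3)) :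
    InnerProductGeometry.angle (perpPart u v) (perpPart u w) =
      InnerProductGeometry.angle (cross₃ u v) (cross₃ u w) := by
  have : ‖u‖ ≠ 0 := norm_ne_zero_iff.2 hu
  rw [InnerProductGeometry.angle, InnerProductGeometry.angle, inner_perpPart_eq_inner_cross₃ hu,
    norm_perpPart_eq_norm_cross₃ hu, norm_perpPart_eq_norm_cross₃ hu]
  congr 1
  field_simp

theorem cross₃_swap (u v : EuclideanSpace ℝ (Fin 3)) : cross₃ v u = -cross₃ u v := by
  ext i
  fin_cases i <;> simp [cross₃] <;> ring

theorem sum_cos_angle_ge {E : Type*} [NormedAddCommGroup E] [InnerProductSpace ℝ E] (a b c : E) :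
    -3 / 2 ≤ cos (InnerProductGeometry.angle a b) + cos (InnerProductGeometry.angle b c) +
      cos (InnerProductGeometry.angle c a) := by
  have hn : ∀ x : E, ⟪‖x‖⁻¹ • x, ‖x‖⁻¹ • x⟫ ≤ 1 := fun x => by
    rcases eq_or_ne x 0 with rfl | hx
    · simp
    · have := norm_ne_zero_iff.2 hx
      rw [real_inner_smul_left, real_inner_smul_right, real_inner_self_eq_norm_sq]
      field_simp
      rfl
  have hc : ∀ x y : E, cos (InnerProductGeometry.angle x y) = ⟪‖x‖⁻¹ • x, ‖y‖⁻¹ • y⟫ :=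
    fun x y => by
      rw [InnerProductGeometry.cos_angle, real_inner_smul_left, real_inner_smul_right,
        div_eq_mul_inv, mul_inv]
      ring
  rw [hc, hc, hc]
  have h0 := real_inner_self_nonneg (x := ‖a‖⁻¹ • a + ‖b‖⁻¹ • b + ‖c‖⁻¹ • c)
  have ha := hn a
  have hb := hn b
  have hc := hn c
  generalize ‖a‖⁻¹ • a = a at *
  generalize ‖b‖⁻¹ • b = b at *
  generalize ‖c‖⁻¹ • c = c at *
  simp only [inner_add_left, inner_add_right] at h0
  linarith [real_inner_comm a b, real_inner_comm b c, real_inner_comm c a]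

theorem exists_dihedralAngle_ge {P Q R S : EuclideanSpace ℝ (Fin 3)} (hQ : Q ≠ P) (hR : R ≠ P)
    (hS : S ≠ P) : π / 3 ≤ dihedralAngle P Q R S ∨ π / 3 ≤ dihedralAngle P R S Q ∨
      π / 3 ≤ dihedralAngle P S Q R := by
  by_contra! h
  have hcos : ∀ {x y : EuclideanSpace ℝ (Fin 3)}, InnerProductGeometry.angle x y < π / 3 →
      1 / 2 < cos (InnerProductGeometry.angle x y) := fun {x y} hxy => by
    rw [← cos_pi_div_three]
    exact cos_lt_cos_of_nonneg_of_le_pi (InnerProductGeometry.angle_nonneg _ _)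
      (by linarith [pi_pos]) hxy
  have h1 := hcos h.1
  have h2 := hcos h.2.1
  have h3 := hcos h.2.2
  rw [angle_perpPart_eq_angle_cross₃ (sub_ne_zero.2 ‹_›), cross₃_swap,
    InnerProductGeometry.angle_neg_left, cos_pi_sub] at h1 h2 h3
  rw [InnerProductGeometry.angle_comm] at h1 h2 h3
  linarith [sum_cos_angle_ge (cross₃ (Q - P) (S - P)) (cross₃ (R - P) (Q - P))
    (cross₃ (S - P) (R - P))]

theorem min_sin_le {a b x : ℝ} (ha : 0 ≤ a) (hb : b ≤ π) (hx : x ∈ Set.Icc a b) :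
    min (sin a) (sin b) ≤ sin x :=
  have hab := hx.1.trans hx.2
  strictConcaveOn_sin_Icc.concaveOn.min_le_of_mem_Icc ⟨ha, hab.trans hb⟩ ⟨ha.trans hab, hb⟩ hx

/-- In a triangle with angles at most `θM`, one of the two sides other than `PQ` makes an angle
at least `(π - θM) / 2` with `PQ`. -/
theorem exists_side_angle_mem_Icc {ι : Type*} {V : ι → EuclideanSpace ℝ (Fin 3)} {θM : ℝ}
    (hV : Function.Injective V)
    (hface : ∀ i j k, i ≠ j → j ≠ k → i ≠ k → ∠ (V i) (V j) (V k) ≤ θM)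
    {i j k : ι} (hij : i ≠ j) (hjk : j ≠ k) (hik : i ≠ k) :
    ∃ a, (a = i ∨ a = j) ∧ ∃ θ ∈ Set.Icc ((π - θM) / 2) θM,
      sin θ * dist (V a) (V k) = ‖perpPart (V j - V i) (V k - V i)‖ := by
  have hne : V j - V i ≠ 0 := sub_ne_zero.2 (hV.ne hij.symm)
  have hsum := angle_add_angle_add_angle_eq_pi (V k) (hV.ne hij.symm)
  have hk := hface j k i hjk hik.symm hij.symm
  have hj := hface i j k hij hjk hik
  have hi := hface k i j hik.symm hij hjk.symm
  by_cases h : (π - θM) / 2 ≤ ∠ (V k) (V i) (V j)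
  · refine ⟨i, .inl rfl, _, ⟨h, hi⟩, ?_⟩
    rw [dist_comm, dist_eq_norm, angle_comm]
    exact sin_angle_mul_norm_eq_norm_perpPart hne _
  · refine ⟨j, .inr rfl, _, ⟨by linarith, hj⟩, ?_⟩
    rw [dist_comm, dist_eq_norm, ← perpPart_sub_self hne, sub_sub_sub_cancel_right,
      ← perpPart_neg, ← sin_angle_mul_norm_eq_norm_perpPart (neg_ne_zero.2 hne), neg_sub]
    rfl

theorem det₃_smul (a b c : ℝ) (u v w : EuclideanSpace ℝ (Fin 3)) :
    det₃ (a • u) (b • v) (c • w) = a * b * c * det₃ u v w := by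
  simp only [det₃_eq, PiLp.smul_apply, smul_eq_mul]
  ring

theorem det₃_sub_sub (P Q R S A B : EuclideanSpace ℝ (Fin 3)) (hA : A = P ∨ A = Q)
    (hB : B = P ∨ B = Q) : det₃ (Q - P) (R - A) (S - B) = det₃ (Q - P) (R - P) (S - P) := by
  rcases hA with rfl | rfl <;> rcases hB with rfl | rfl <;>
    simp only [det₃_eq, PiLp.sub_apply] <;> ring

/-- three edges with uniformly nondegenerate directions in a tetrahedron
satisfying the maximum angle condition: if every face angle and every dihedral angle
of the tetrahedron `V` is at most `θM < π`, then there are three edges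
`e_m = (V (p m).1, V (p m).2)` and angles `θ 0 ∈ [π/3, θM]` (the dihedral angle of
the edge `e₀`) and `θ 1, θ 2 ∈ [(π−θM)/2, θM]` with
`|det[t₁,t₂,t₃]| = sin θ₀ sin θ₁ sin θ₂ ≥ c_m`, where
`c_m = min{√3/2, sin θM} · min{cos(θM/2), sin θM}²`, and moreover
`(c_m/6)|e₀||e₁||e₂| ≤ |T| ≤ (1/6)|e₀||e₁||e₂|`. -/
theorem stmt11
    (V : Fin 4 → EuclideanSpace ℝ (Fin 3))
    (hnd : AffineIndependent ℝ V)
    (θM : ℝ) (hθM : θM < π)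
    (hface : ∀ i j k : Fin 4, i ≠ j → j ≠ k → i ≠ k → ∠ (V i) (V j) (V k) ≤ θM)
    (hdihedral : ∀ i j k l : Fin 4, ({i, j, k, l} : Finset (Fin 4)) = Finset.univ →
      dihedralAngle (V i) (V j) (V k) (V l) ≤ θM) :
    ∃ (p : Fin 3 → Fin 4 × Fin 4) (θ : Fin 3 → ℝ),
      (∀ m, (p m).1 ≠ (p m).2) ∧
      (∃ k₁ k₂ : Fin 4, ({(p 0).1, (p 0).2, k₁, k₂} : Finset (Fin 4)) = Finset.univ ∧
        θ 0 = dihedralAngle (V (p 0).1) (V (p 0).2) (V k₁) (V k₂)) ∧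
      θ 0 ∈ Set.Icc (π / 3) θM ∧
      θ 1 ∈ Set.Icc ((π - θM) / 2) θM ∧
      θ 2 ∈ Set.Icc ((π - θM) / 2) θM ∧
      |Matrix.det (Matrix.of fun m j => unitDir (V (p m).1) (V (p m).2) j)|
          = Real.sin (θ 0) * Real.sin (θ 1) * Real.sin (θ 2) ∧
      min (Real.sqrt 3 / 2) (Real.sin θM) * (min (Real.cos (θM / 2)) (Real.sin θM)) ^ 2
          ≤ Real.sin (θ 0) * Real.sin (θ 1) * Real.sin (θ 2) ∧
      min (Real.sqrt 3 / 2) (Real.sin θM) * (min (Real.cos (θM / 2)) (Real.sin θM)) ^ 2 / 6 *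
          (dist (V (p 0).1) (V (p 0).2) * dist (V (p 1).1) (V (p 1).2) * dist (V (p 2).1) (V (p 2).2))
        ≤ (MeasureTheory.volume (convexHull ℝ (Set.range V))).toReal ∧
      (MeasureTheory.volume (convexHull ℝ (Set.range V))).toReal
        ≤ 1 / 6 *
          (dist (V (p 0).1) (V (p 0).2) * dist (V (p 1).1) (V (p 1).2) * dist (V (p 2).1) (V (p 2).2)) := by
  have hV := hnd.injective
  obtain ⟨i, j, k, l, huniv, hij, hik, hil, hjk, hjl, hθ⟩ : ∃ i j k l : Fin 4,
      ({i, j, k, l} : Finset (Fin 4)) = Finset.univ ∧ i ≠ j ∧ i ≠ k ∧ i ≠ l ∧ j ≠ k ∧ j ≠ l ∧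
        π / 3 ≤ dihedralAngle (V i) (V j) (V k) (V l) := by
    rcases exists_dihedralAngle_ge (hV.ne (show (1 : Fin 4) ≠ 0 by decide))
      (hV.ne (show (2 : Fin 4) ≠ 0 by decide)) (hV.ne (show (3 : Fin 4) ≠ 0 by decide))
      with h | h | h
    · exact ⟨0, 1, 2, 3, by decide, by decide, by decide, by decide, by decide, by decide, h⟩
    · exact ⟨0, 2, 3, 1, by decide, by decide, by decide, by decide, by decide, by decide, h⟩
    · exact ⟨0, 3, 1, 2, by decide, by decide, by decide, by decide, by decide, by decide, h⟩
  obtain ⟨a, ha, θa, hθa, hna⟩ := exists_side_angle_mem_Icc hV hface hij hjk hik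
  obtain ⟨b, hb, θb, hθb, hnb⟩ := exists_side_angle_mem_Icc hV hface hij hjl hil
  have hak : a ≠ k := by rcases ha with rfl | rfl <;> assumption
  have hbl : b ≠ l := by rcases hb with rfl | rfl <;> assumption
  set α := dihedralAngle (V i) (V j) (V k) (V l) with hα
  have hαM : α ≤ θM := hdihedral i j k l huniv
  have hdet : |det₃ (V j - V i) (V k - V i) (V l - V i)| =
      sin α * sin θa * sin θb * (dist (V i) (V j) * dist (V a) (V k) * dist (V b) (V l)) := by
    rw [abs_det₃_eq (sub_ne_zero.2 (hV.ne hij.symm)), ← hna, ← hnb, hα, dihedralAngle,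
      dist_comm (V i), dist_eq_norm (V j)]
    ring
  have hvol : (volume (convexHull ℝ (Set.range V))).toReal = sin α * sin θa * sin θb *
      (dist (V i) (V j) * dist (V a) (V k) * dist (V b) (V l)) / 6 := by
    rw [← hdet, ← volume_convexHull_tetrahedron]
    congr 3
    rw [← Set.image_univ, ← Finset.coe_univ, ← huniv]
    simp only [Matrix.range_cons, Matrix.range_empty, Finset.coe_insert, Finset.coe_singleton,
      Set.image_insert_eq, Set.image_singleton, Set.union_empty, Set.singleton_union]
  have h0 : 0 < dist (V i) (V j) := dist_pos.2 (hV.ne hij)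
  have h1 : 0 < dist (V a) (V k) := dist_pos.2 (hV.ne hak)
  have h2 : 0 < dist (V b) (V l) := dist_pos.2 (hV.ne hbl)
  have hθM0 : 0 < θM := by linarith [pi_pos]
  have hcos : 0 ≤ min (cos (θM / 2)) (sin θM) :=
    le_min (cos_nonneg_of_mem_Icc ⟨by linarith, by linarith⟩) (sin_pos_of_pos_of_lt_pi hθM0 hθM).le
  have hside : ∀ θ ∈ Set.Icc ((π - θM) / 2) θM, min (cos (θM / 2)) (sin θM) ≤ sin θ := by
    intro θ hθ
    have := min_sin_le (by linarith) hθM.le hθ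
    rwa [show (π - θM) / 2 = π / 2 - θM / 2 by ring, sin_pi_div_two_sub] at this
  have hsα : min (√3 / 2) (sin θM) ≤ sin α := by
    rw [← sin_pi_div_three]
    exact min_sin_le (by positivity) hθM.le ⟨hθ, hαM⟩
  have hsα0 : 0 ≤ sin α :=
    sin_nonneg_of_nonneg_of_le_pi (by linarith [pi_pos]) (by linarith)
  have hsa := hside θa hθa
  have hsb := hside θb hθb
  have hlow : min (√3 / 2) (sin θM) * (min (cos (θM / 2)) (sin θM)) ^ 2 ≤
      sin α * sin θa * sin θb := by
    rw [sq, ← mul_assoc]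
    gcongr
    exact mul_nonneg hsα0 (hcos.trans hsa)
  have hup : sin α * sin θa * sin θb ≤ 1 :=
    mul_le_one₀ (mul_le_one₀ (sin_le_one _) (hcos.trans hsa) (sin_le_one _)) (hcos.trans hsb)
      (sin_le_one _)
  refine ⟨![(i, j), (a, k), (b, l)], ![α, θa, θb], ?_, ⟨k, l, huniv, rfl⟩, ⟨hθ, hαM⟩, hθa, hθb, ?_,
    hlow, ?_, ?_⟩
  · intro m
    fin_cases m <;> assumption
  · have hrows : Matrix.of (fun m x => unitDir (V ((![(i, j), (a, k), (b, l)] : Fin 3 → _) m).1)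
        (V ((![(i, j), (a, k), (b, l)] : Fin 3 → _) m).2) x) = Matrix.of
        ![(unitDir (V i) (V j)).ofLp, (unitDir (V a) (V k)).ofLp, (unitDir (V b) (V l)).ofLp] := by
      ext m x
      fin_cases m <;> rfl
    rw [hrows, ← det₃, unitDir, unitDir, unitDir, det₃_smul, det₃_sub_sub _ _ _ _ _ _
      (ha.imp (congrArg V) (congrArg V)) (hb.imp (congrArg V) (congrArg V)), abs_mul, hdet,
      ← dist_eq_norm, ← dist_eq_norm, ← dist_eq_norm, dist_comm (V j), dist_comm (V k),
      dist_comm (V l), abs_of_pos (mul_pos (mul_pos (inv_pos.2 h0) (inv_pos.2 h1)) (inv_pos.2 h2))]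
    simp only [Matrix.cons_val]
    field_simp
  · rw [hvol, div_mul_eq_mul_div]
    simp only [Matrix.cons_val]
    gcongr
  · rw [hvol, div_eq_inv_mul, one_div]
    simp only [Matrix.cons_val]
    exact mul_le_mul_of_nonneg_left (mul_le_of_le_one_left (by positivity) hup) (by norm_num)
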